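/- Let R be a commutative ring containing the field of rational numbers, let φ : R^m → R^n be an R-linear map, and let d ≥ 1. Then I(S^d(φ)) = I(φ)^s, where s = binomial(n+d-1, d-1). -/

import Mathlib

noncomputable section

/-- `I_t(A)`: the ideal of `R` generated by the `t × t` minors of the matrix `A`. -/
def minorsIdeal {R : Type*} [CommRing R] (t : ℕ) {N M : Type*} (A : Matrix N M R) : Ideal R :=
  Ideal.span {x : R | ∃ (r : Fin t → N) (c : Fin t → M), x = (A.submatrix r c).det}

/-- The matrix (in the standard bases of monomials) of the `d`-th symmetric power
`S^d(φ) : S^d(R^m) → S^d(R^n)` of the linear map `φ : R^m → R^n` given by the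
`n × m` matrix `A`: the `(μ, ν)` entry is the coefficient of the monomial `x^μ` in
`Π_{j ∈ ν} φ(x_j)`, computed in the symmetric algebra `R[x_1, …, x_n]` of `R^n`. -/
def symPowMatrix {R : Type*} [CommRing R] {m n : ℕ} (d : ℕ) (A : Matrix (Fin n) (Fin m) R) :
    Matrix (Sym (Fin n) d) (Sym (Fin m) d) R := fun μ ν =>
  MvPolynomial.coeff (Multiset.toFinsupp (μ : Multiset (Fin n)))
    (((ν : Multiset (Fin m)).map fun j =>
        ∑ i : Fin n, MvPolynomial.C (A i j) * MvPolynomial.X i).prod)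

section ApolarPairing

open MvPolynomial Nat

variable {σ R : Type*} [Fintype σ] [CommRing R]

/-- The apolar pairing `⟨P, Q⟩ = P(∂) Q |_{x = 0}`, linear in `P`. On monomials,
`⟨x^μ, x^ν⟩ = δ_{μν} μ!`. -/
def apolarPairing (Q : MvPolynomial σ R) : MvPolynomial σ R →ₗ[R] R :=
  (basisMonomials σ R).constr R fun μ => coeff μ Q * ∏ i, ((μ i)! : R)

theorem apolarPairing_monomial (Q : MvPolynomial σ R) (μ : σ →₀ ℕ) (a : R) :
    apolarPairing Q (monomial μ a) = a * (coeff μ Q * ∏ i, ((μ i)! : R)) := by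
  have h : monomial μ a = a • basisMonomials σ R μ := by
    simp [smul_monomial]
  rw [h, map_smul, apolarPairing, Module.Basis.constr_basis, smul_eq_mul]

theorem apolarPairing_C (Q : MvPolynomial σ R) (a : R) :
    apolarPairing Q (C a) = a * coeff 0 Q := by
  rw [C_apply, apolarPairing_monomial]
  simp

theorem apolarPairing_eq_sum (P Q : MvPolynomial σ R) :
    apolarPairing Q P = ∑ μ ∈ P.support, coeff μ P * (coeff μ Q * ∏ i, ((μ i)! : R)) := by
  conv_lhs => rw [P.as_sum, map_sum]
  simp only [apolarPairing_monomial]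

theorem apolarPairing_sum {ι : Type*} (s : Finset ι) (Q : ι → MvPolynomial σ R)
    (P : MvPolynomial σ R) :
    apolarPairing (∑ k ∈ s, Q k) P = ∑ k ∈ s, apolarPairing (Q k) P := by
  simp only [apolarPairing_eq_sum, coeff_sum, Finset.sum_mul, Finset.mul_sum]
  exact Finset.sum_comm

theorem apolarPairing_C_mul (a : R) (Q P : MvPolynomial σ R) :
    apolarPairing (C a * Q) P = a * apolarPairing Q P := by
  simp only [apolarPairing_eq_sum, coeff_C_mul, Finset.mul_sum]
  exact Finset.sum_congr rfl fun _ _ => by ring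

theorem apolarPairing_C_mul_right (a : R) (Q P : MvPolynomial σ R) :
    apolarPairing Q (C a * P) = a * apolarPairing Q P := by
  rw [← smul_eq_C_mul, map_smul, smul_eq_mul]

theorem apolarPairing_X_mul [DecidableEq σ] (i : σ) (Q P : MvPolynomial σ R) :
    apolarPairing Q (X i * P) = apolarPairing (pderiv i Q) P := by
  induction P using MvPolynomial.induction_on' with
  | add p q hp hq => rw [mul_add, map_add, map_add, hp, hq]
  | monomial μ a =>
    rw [X, monomial_mul, one_mul, apolarPairing_monomial, apolarPairing_monomial, coeff_pderiv,
      add_comm (Finsupp.single i 1) μ, Fintype.prod_eq_mul_prod_compl i,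
      Fintype.prod_eq_mul_prod_compl i]
    have h : ∀ j ∈ ({i}ᶜ : Finset σ), (((μ + (Finsupp.single i 1 : σ →₀ ℕ)) j)! : R) = ((μ j)! : R) := by
      intro j hj
      have hj' : i ≠ j := fun h => by simp [h] at hj
      simp [hj']
    rw [Finset.prod_congr rfl h]
    simp only [Finsupp.add_apply, Finsupp.single_eq_same, Nat.factorial_succ]
    push_cast
    ring

theorem apolarPairing_mem {J : Ideal R} {Q : MvPolynomial σ R}
    (hQ : Q ∈ J.map (C : R →+* MvPolynomial σ R)) (P : MvPolynomial σ R) :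
    apolarPairing Q P ∈ J := by
  rw [mem_map_C_iff] at hQ
  rw [apolarPairing_eq_sum]
  exact J.sum_mem fun μ _ => J.mul_mem_left _ (J.mul_mem_right _ (hQ μ))

theorem apolarPairing_map {S : Type*} [CommRing S] (f : S →+* R) (P Q : MvPolynomial σ S) :
    apolarPairing (map f Q) (map f P) = f (apolarPairing Q P) := by
  induction P using MvPolynomial.induction_on' with
  | add p q hp hq => rw [map_add, map_add, map_add, map_add, hp, hq]
  | monomial μ a => simp [apolarPairing_monomial, coeff_map]

theorem apolarPairing_self_pos {P : MvPolynomial σ ℚ} (hP : P ≠ 0) : 0 < apolarPairing P P := by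
  rw [apolarPairing_eq_sum]
  refine Finset.sum_pos (fun μ hμ => ?_) (support_nonempty.mpr hP)
  rw [← mul_assoc]
  exact mul_pos (mul_self_pos.mpr (mem_support_iff.mp hμ))
    (Finset.prod_pos fun i _ => by exact_mod_cast Nat.factorial_pos _)

end ApolarPairing

section LinearSubstitution

open MvPolynomial

variable {α β R : Type*} [Fintype β] [CommRing R]

/-- The linear substitution `x_a ↦ ∑ b, M a b * x_b`. -/
def linearSubst (M : Matrix α β R) : MvPolynomial α R →ₐ[R] MvPolynomial β R :=
  aeval fun a => ∑ b, C (M a b) * X b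

theorem linearSubst_X (M : Matrix α β R) (a : α) :
    linearSubst M (X a) = ∑ b, C (M a b) * X b := by
  rw [linearSubst, aeval_X]

theorem linearSubst_C (M : Matrix α β R) (r : R) : linearSubst M (C r) = C r := by
  rw [linearSubst, aeval_C, algebraMap_eq]

theorem linearSubst_mul {γ : Type*} [Fintype γ] (M : Matrix α β R) (N : Matrix β γ R)
    (P : MvPolynomial α R) :
    linearSubst (M * N) P = linearSubst N (linearSubst M P) := by
  rw [← AlgHom.comp_apply]
  congr 1
  ext1 a
  simp only [AlgHom.comp_apply, linearSubst_X, map_sum, map_mul, linearSubst_C, Matrix.mul_apply,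
    Finset.sum_mul, Finset.mul_sum, mul_assoc]
  exact Finset.sum_comm

theorem pderiv_linearSubst [Fintype α] [DecidableEq α] [DecidableEq β] (M : Matrix α β R) (b : β)
    (Q : MvPolynomial α R) :
    pderiv b (linearSubst M Q) = ∑ a, C (M a b) * linearSubst M (pderiv a Q) := by
  induction Q using MvPolynomial.induction_on with
  | C r => simp
  | add p q hp hq => simp only [map_add, hp, hq, mul_add, Finset.sum_add_distrib]
  | mul_X p c hp =>
    have hX : pderiv b (linearSubst M (X c)) = C (M c b) := by
      simp [linearSubst_X, pderiv_X, Pi.single_apply, eq_comm]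
    have hs : ∑ a, C (M a b) * (linearSubst M p * linearSubst M (pderiv a (X c))) =
        linearSubst M p * C (M c b) := by
      rw [Finset.sum_eq_single c]
      · simp [mul_comm]
      · intro a _ ha
        rw [pderiv_X_of_ne ha.symm]
        simp
      · simp
    simp only [map_mul, pderiv_mul, map_add, mul_add, Finset.sum_add_distrib]
    rw [hp, hX, hs, Finset.sum_mul]
    simp only [mul_assoc]

theorem apolarPairing_linearSubst [Fintype α] [DecidableEq α] [DecidableEq β] (M : Matrix α β R)
    (P : MvPolynomial α R) (Q : MvPolynomial β R) :
    apolarPairing Q (linearSubst M P) = apolarPairing (linearSubst M.transpose Q) P := by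
  induction P using MvPolynomial.induction_on generalizing Q with
  | C r =>
    rw [linearSubst_C, apolarPairing_C, apolarPairing_C, ← constantCoeff_eq, ← constantCoeff_eq]
    congr 1
    induction Q using MvPolynomial.induction_on with
    | C r => rw [linearSubst_C]; simp
    | add p q hp hq => simp only [map_add, hp, hq]
    | mul_X p c _ => simp [linearSubst_X]
  | add p q hp hq => simp only [map_add, hp, hq]
  | mul_X p a hp =>
    rw [map_mul, linearSubst_X, mul_comm, mul_comm p, apolarPairing_X_mul, pderiv_linearSubst,
      apolarPairing_sum, Finset.sum_mul, map_sum]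
    refine Finset.sum_congr rfl fun b _ => ?_
    rw [mul_assoc, apolarPairing_C_mul_right, apolarPairing_X_mul, hp, apolarPairing_C_mul,
      Matrix.transpose_apply]

end LinearSubstitution

section SymPow

open MvPolynomial

variable {R : Type*} [CommRing R] {l m n : ℕ} (d : ℕ)

theorem monomial_toFinsupp {σ : Type*} [DecidableEq σ] (s : Multiset σ) :
    (monomial (Multiset.toFinsupp s) 1 : MvPolynomial σ R) = (s.map X).prod := by
  induction s using Multiset.induction_on with
  | empty => simp
  | cons a s ih =>
    rw [Multiset.map_cons, Multiset.prod_cons, ← ih, X, monomial_mul, one_mul,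
      ← Multiset.singleton_add, map_add, Multiset.toFinsupp_singleton]

theorem symPowMatrix_apply (A : Matrix (Fin n) (Fin m) R) (μ : Sym (Fin n) d)
    (ν : Sym (Fin m) d) :
    symPowMatrix d A μ ν = coeff (Multiset.toFinsupp (μ : Multiset (Fin n)))
      (linearSubst A.transpose
        (monomial (Multiset.toFinsupp (ν : Multiset (Fin m))) 1)) := by
  rw [monomial_toFinsupp, map_multiset_prod, Multiset.map_map]
  simp only [Function.comp_def, linearSubst_X, Matrix.transpose_apply]
  rfl

theorem MvPolynomial.IsHomogeneous.eq_sum_sym {σ : Type*} [Fintype σ] [DecidableEq σ] {d : ℕ}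
    {p : MvPolynomial σ R} (hp : p.IsHomogeneous d) :
    p = ∑ μ : Sym σ d, C (coeff (Multiset.toFinsupp (μ : Multiset σ)) p) *
      monomial (Multiset.toFinsupp (μ : Multiset σ)) 1 := by
  ext k
  simp only [coeff_sum, coeff_C_mul, coeff_monomial, mul_ite, mul_one, mul_zero]
  by_cases hk : Multiset.card (Finsupp.toMultiset k) = d
  · rw [Fintype.sum_eq_single (Sym.mk (Finsupp.toMultiset k) hk)]
    · simp
    · intro μ hμ
      rw [if_neg]
      rintro rfl
      exact hμ (Subtype.ext (by simp))
  · rw [Finset.sum_eq_zero]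
    · by_contra h
      refine hk ?_
      have := hp h
      rw [← this, Finsupp.card_toMultiset, Finsupp.weight_apply]
      simp [Finsupp.sum]
    · intro μ _
      rw [if_neg]
      rintro rfl
      exact hk (by simp)

theorem linearSubst_isHomogeneous {α β : Type*} [Fintype β] (M : Matrix α β R)
    {p : MvPolynomial α R} {d : ℕ} (hp : p.IsHomogeneous d) :
    (linearSubst M p).IsHomogeneous d := by
  have := hp.aeval (fun a => ∑ b, C (M a b) * X b) (n := 1) fun a =>
    IsHomogeneous.sum _ _ _ fun b _ => (isHomogeneous_X R b).C_mul (M a b)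
  simpa [linearSubst] using this

theorem isHomogeneous_monomial_sym {σ : Type*} [DecidableEq σ] {d : ℕ} (ν : Sym σ d) :
    (monomial (Multiset.toFinsupp (ν : Multiset σ)) (1 : R)).IsHomogeneous d := by
  refine isHomogeneous_monomial _ ?_
  have h := Multiset.toFinsupp_sum_eq (ν : Multiset σ)
  rw [Sym.card_coe] at h
  exact h

theorem symPowMatrix_mul (A : Matrix (Fin l) (Fin n) R) (B : Matrix (Fin n) (Fin m) R) :
    symPowMatrix d (A * B) = symPowMatrix d A * symPowMatrix d B := by
  ext μ ν
  rw [Matrix.mul_apply, symPowMatrix_apply, Matrix.transpose_mul, linearSubst_mul,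
    (linearSubst_isHomogeneous B.transpose (isHomogeneous_monomial_sym ν)).eq_sum_sym]
  simp only [map_sum, map_mul, linearSubst_C, coeff_sum, coeff_C_mul, symPowMatrix_apply]
  exact Finset.sum_congr rfl fun _ _ => mul_comm _ _

theorem symPowMatrix_map {S : Type*} [CommRing S] (f : R →+* S) (A : Matrix (Fin n) (Fin m) R) :
    symPowMatrix d (A.map f) = (symPowMatrix d A).map f := by
  ext μ ν
  rw [Matrix.map_apply, symPowMatrix, symPowMatrix, ← coeff_map, map_multiset_prod,
    Multiset.map_map]
  simp

theorem symPowMatrix_diagonal (D : Fin n → R) :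
    symPowMatrix d (Matrix.diagonal D) =
      Matrix.diagonal fun μ : Sym (Fin n) d => ((μ : Multiset (Fin n)).map D).prod := by
  ext μ ν
  have h : symPowMatrix d (Matrix.diagonal D) μ ν =
      coeff (Multiset.toFinsupp (μ : Multiset (Fin n)))
        (C ((ν : Multiset (Fin n)).map D).prod *
          monomial (Multiset.toFinsupp (ν : Multiset (Fin n))) (1 : R)) := by
    rw [monomial_toFinsupp, map_multiset_prod, Multiset.map_map, ← Multiset.prod_map_mul]
    have hsum : ∀ j : Fin n, ∑ i, C (if i = j then D i else 0) * (X i : MvPolynomial (Fin n) R) =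
        C (D j) * X j := fun j => by
      rw [Fintype.sum_eq_single j fun i hi => by simp [hi], if_pos rfl]
    simp [symPowMatrix, Matrix.diagonal_apply, hsum]
  rw [h, coeff_C_mul, coeff_monomial, Matrix.diagonal_apply]
  by_cases hμ : μ = ν
  · simp [hμ]
  · rw [if_neg hμ, if_neg, mul_zero]
    intro h
    exact hμ (Subtype.ext (Multiset.toFinsupp.injective h).symm)

theorem sum_count_sym (hd : 1 ≤ d) (i : Fin n) :
    ∑ μ : Sym (Fin n) d, (μ : Multiset (Fin n)).count i = (n + d - 1).choose (d - 1) := by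
  have hsymm : ∀ j : Fin n, ∑ μ : Sym (Fin n) d, (μ : Multiset (Fin n)).count j =
      ∑ μ : Sym (Fin n) d, (μ : Multiset (Fin n)).count i := by
    intro j
    refine Fintype.sum_equiv (Sym.equivCongr (Equiv.swap i j)) _ _ fun μ => ?_
    have h := Multiset.count_map_eq_count' (Equiv.swap i j) (μ : Multiset (Fin n))
      (Equiv.injective _) j
    rw [Equiv.swap_apply_right] at h
    exact h.symm
  have htotal : ∑ j : Fin n, ∑ μ : Sym (Fin n) d, (μ : Multiset (Fin n)).count j =
      (n + d - 1).choose d * d := by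
    rw [Finset.sum_comm]
    have h : ∀ μ : Sym (Fin n) d, ∑ j : Fin n, (μ : Multiset (Fin n)).count j = d := fun μ => by
      rw [Multiset.sum_count_eq_card (fun a _ => Finset.mem_univ a), Sym.card_coe]
    simp only [h, Finset.sum_const, Finset.card_univ, Sym.card_sym_eq_choose, Fintype.card_fin,
      smul_eq_mul]
  simp only [hsymm, Finset.sum_const, Finset.card_univ, Fintype.card_fin, smul_eq_mul] at htotal
  obtain ⟨e, rfl⟩ := Nat.exists_eq_add_of_le' hd
  have hn : 0 < n := i.pos
  have h := Nat.choose_succ_right_eq (n + (e + 1) - 1) e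
  rw [h] at htotal
  have h' : n + (e + 1) - 1 - e = n := by omega
  rw [h', mul_comm] at htotal
  simpa using Nat.eq_of_mul_eq_mul_right hn htotal

theorem det_symPowMatrix_diagonal (hd : 1 ≤ d) (D : Fin n → R) :
    (symPowMatrix d (Matrix.diagonal D)).det =
      (Matrix.diagonal D).det ^ (n + d - 1).choose (d - 1) := by
  rw [symPowMatrix_diagonal, Matrix.det_diagonal, Matrix.det_diagonal]
  simp only [Finset.prod_multiset_map_count, ← Finset.prod_pow]
  have h : ∀ μ : Sym (Fin n) d, ∏ i ∈ (μ : Multiset (Fin n)).toFinset,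
      D i ^ (μ : Multiset (Fin n)).count i = ∏ i, D i ^ (μ : Multiset (Fin n)).count i :=
    fun μ => Finset.prod_subset (Finset.subset_univ _) fun i _ hi => by
      rw [Multiset.mem_toFinset] at hi
      rw [Multiset.count_eq_zero_of_notMem hi, pow_zero]
  simp only [h]
  rw [Finset.prod_comm]
  exact Finset.prod_congr rfl fun i _ => by rw [Finset.prod_pow_eq_pow_sum, sum_count_sym d hd]

theorem symPowMatrix_one : symPowMatrix d (1 : Matrix (Fin n) (Fin n) R) = 1 := by
  rw [← Matrix.diagonal_one, symPowMatrix_diagonal]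
  simp

theorem det_symPowMatrix_transvection [Invertible (2 : R)] {i j : Fin n} (hij : i ≠ j) (c : R) :
    (symPowMatrix d (Matrix.transvection i j c)).det = 1 := by
  let F : Matrix (Fin n) (Fin n) R → R := fun A => (symPowMatrix d A).det
  have hmul : ∀ A B, F (A * B) = F A * F B := fun A B => by
    simp only [F, symPowMatrix_mul, Matrix.det_mul]
  have hone : F 1 = 1 := by simp only [F, symPowMatrix_one, Matrix.det_one]
  let D : Matrix (Fin n) (Fin n) R := Matrix.diagonal (Function.update 1 i 2)
  let E : Matrix (Fin n) (Fin n) R := Matrix.diagonal (Function.update 1 i (⅟ 2))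
  have hDE : D * E = 1 := by
    rw [Matrix.diagonal_mul_diagonal, ← Matrix.diagonal_one]
    congr 1
    ext k
    by_cases hk : k = i
    · subst hk; simp
    · simp [hk]
  have hconj : D * Matrix.transvection i j c =
      Matrix.transvection i j c * Matrix.transvection i j c * D := by
    rw [Matrix.transvection_mul_transvection_same _ _ hij]
    ext a b
    clear hmul hone hDE
    simp only [D, Matrix.diagonal_mul, Matrix.mul_diagonal, Matrix.transvection, Matrix.add_apply,
      Matrix.one_apply, Matrix.single_apply, Function.update_apply, Pi.one_apply]
    by_cases ha : a = i <;> by_cases hb : b = j <;> by_cases hab : a = b <;>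
      simp_all [eq_comm]
    ring
  have hinv : F (Matrix.transvection i j c) * F (Matrix.transvection i j (-c)) = 1 := by
    rw [← hmul, Matrix.transvection_mul_transvection_same _ _ hij, add_neg_cancel,
      Matrix.transvection_zero, hone]
  have hDE' : F D * F E = 1 := by rw [← hmul, hDE, hone]
  have h := congrArg F hconj
  simp only [hmul] at h
  change F (Matrix.transvection i j c) = 1
  linear_combination -F E * F (Matrix.transvection i j (-c)) * h -
    (F (Matrix.transvection i j c) - 1) * (F D * F E) * hinv -
    (F (Matrix.transvection i j c) - 1) * hDE'

theorem det_symPowMatrix_of_field {K : Type*} [Field K] [CharZero K] (hd : 1 ≤ d)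
    (A : Matrix (Fin n) (Fin n) K) :
    (symPowMatrix d A).det = A.det ^ (n + d - 1).choose (d - 1) := by
  have : Invertible (2 : K) := invertibleOfNonzero two_ne_zero
  refine Matrix.diagonal_transvection_induction
    (fun A => (symPowMatrix d A).det = A.det ^ (n + d - 1).choose (d - 1)) A
    (fun D _ => det_symPowMatrix_diagonal d hd D) (fun t => ?_) fun A B hA hB => ?_
  · rw [Matrix.TransvectionStruct.det, one_pow]
    exact det_symPowMatrix_transvection d t.hij t.c
  · rw [symPowMatrix_mul, Matrix.det_mul, Matrix.det_mul, hA, hB, mul_pow]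

theorem det_symPowMatrix (hd : 1 ≤ d) (A : Matrix (Fin n) (Fin n) R) :
    (symPowMatrix d A).det = A.det ^ (n + d - 1).choose (d - 1) := by
  let P := MvPolynomial (Fin n × Fin n) ℤ
  have hP : (symPowMatrix d (Matrix.mvPolynomialX (Fin n) (Fin n) ℤ)).det =
      (Matrix.mvPolynomialX (Fin n) (Fin n) ℤ).det ^ (n + d - 1).choose (d - 1) := by
    have : CharZero (FractionRing P) :=
      charZero_of_injective_algebraMap (IsFractionRing.injective P (FractionRing P))
    apply IsFractionRing.injective P (FractionRing P)
    rw [map_pow, RingHom.map_det, RingHom.map_det, RingHom.mapMatrix_apply,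
      RingHom.mapMatrix_apply, ← symPowMatrix_map]
    exact det_symPowMatrix_of_field d hd _
  have h := congrArg (eval₂Hom (Int.castRingHom R) fun p : Fin n × Fin n => A p.1 p.2) hP
  rw [map_pow, RingHom.map_det, RingHom.map_det, RingHom.mapMatrix_apply,
    RingHom.mapMatrix_apply, ← symPowMatrix_map] at h
  have hA : (Matrix.mvPolynomialX (Fin n) (Fin n) ℤ).map
      (eval₂Hom (Int.castRingHom R) fun p : Fin n × Fin n => A p.1 p.2) = A :=
    Matrix.mvPolynomialX_map_eval₂ _ A
  rwa [hA] at h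

end SymPow

section MinorsIdeal

variable {R : Type*} [CommRing R] {t : ℕ} {N M : Type*}

theorem det_submatrix_mem_minorsIdeal (A : Matrix N M R) (r : Fin t → N) (c : Fin t → M) :
    (A.submatrix r c).det ∈ minorsIdeal t A :=
  Ideal.subset_span ⟨r, c, rfl⟩

theorem minorsIdeal_eq_span_range [Fintype N] [DecidableEq N] (A : Matrix N M R) (e : Fin t ≃ N) :
    minorsIdeal t A = Ideal.span (Set.range fun c : Fin t → M => (A.submatrix e c).det) := by
  refine le_antisymm (Ideal.span_le.mpr ?_) (Ideal.span_le.mpr ?_)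
  · rintro _ ⟨r, c, rfl⟩
    have h : A.submatrix r c =
        (1 : Matrix N N R).submatrix r e * A.submatrix e c := by
      rw [Matrix.submatrix_mul_equiv, Matrix.one_mul]
    rw [h, Matrix.det_mul]
    exact Ideal.mul_mem_left _ _ (Ideal.subset_span ⟨c, rfl⟩)
  · rintro _ ⟨c, rfl⟩
    exact det_submatrix_mem_minorsIdeal A e c

theorem det_mul_mem_minorsIdeal [Fintype M] (A : Matrix (Fin t) M R) (B : Matrix M (Fin t) R) :
    (A * B).det ∈ minorsIdeal t A := by
  have h : (A * B).transpose = fun j => ∑ k, B k j • fun i => A i k := by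
    ext j i
    simp [Matrix.mul_apply, mul_comm]
  rw [← Matrix.det_transpose, h]
  change Matrix.detRowAlternating.toMultilinearMap (fun j => ∑ k, B k j • fun i => A i k) ∈ _
  rw [MultilinearMap.map_sum]
  refine Ideal.sum_mem _ fun c _ => ?_
  rw [MultilinearMap.map_smul_univ, smul_eq_mul]
  refine Ideal.mul_mem_left _ _ ?_
  have hc := det_submatrix_mem_minorsIdeal A id c
  rwa [← Matrix.det_transpose] at hc

theorem det_mul_mem_minorsIdeal_of_equiv [Fintype N] [DecidableEq N] [Fintype M] (e : Fin t ≃ N)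
    (A : Matrix N M R) (B : Matrix M N R) : (A * B).det ∈ minorsIdeal t A := by
  rw [← Matrix.det_submatrix_equiv_self e, ← Matrix.submatrix_mul_equiv A B e (Equiv.refl M) e]
  refine Ideal.span_le.mpr ?_ (det_mul_mem_minorsIdeal _ _)
  rintro _ ⟨r, c, rfl⟩
  exact det_submatrix_mem_minorsIdeal A (e ∘ r) c

theorem minorsIdeal_map_le {S : Type*} [CommRing S] (f : R →+* S) (A : Matrix N M R) :
    minorsIdeal t (A.map f) ≤ (minorsIdeal t A).map f := by
  refine Ideal.span_le.mpr ?_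
  rintro _ ⟨r, c, rfl⟩
  have h := Ideal.mem_map_of_mem f (det_submatrix_mem_minorsIdeal A r c)
  rwa [RingHom.map_det] at h

end MinorsIdeal

section MaximalMinors

open MvPolynomial Matrix
open scoped Kronecker

variable {R : Type*} [CommRing R] {m n : ℕ}

theorem mvPolynomialX_map_linearSubst {ι κ τ : Type*} [Fintype ι] [DecidableEq ι] [Fintype τ]
    (A : Matrix κ τ R) :
    (mvPolynomialX ι κ R).map (linearSubst ((1 : Matrix ι ι R) ⊗ₖ A)) =
      mvPolynomialX ι τ R * Aᵀ.map (C (σ := ι × τ)) := by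
  ext1 i j
  simp only [map_apply, mvPolynomialX_apply, linearSubst_X, Fintype.sum_prod_type,
    kroneckerMap_apply, one_apply, mul_apply, transpose_apply]
  rw [Fintype.sum_eq_single i fun k hk => by simp [hk.symm]]
  exact Finset.sum_congr rfl fun k _ => by rw [if_pos rfl, one_mul, mul_comm]

theorem isUnit_apolarPairing_map [Algebra ℚ R] {σ : Type*} [Fintype σ] {P : MvPolynomial σ ℚ}
    (hP : P ≠ 0) :
    IsUnit (apolarPairing (map (algebraMap ℚ R) P) (map (algebraMap ℚ R) P)) := by
  rw [apolarPairing_map]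
  exact (IsUnit.mk0 _ (apolarPairing_self_pos hP).ne').map _

theorem isUnit_apolarPairing_det_pow [Algebra ℚ R] (s : ℕ) :
    IsUnit (apolarPairing ((mvPolynomialX (Fin n) (Fin n) R).det ^ s)
      ((mvPolynomialX (Fin n) (Fin n) R).det ^ s)) := by
  have h : map (algebraMap ℚ R) ((mvPolynomialX (Fin n) (Fin n) ℚ).det ^ s) =
      (mvPolynomialX (Fin n) (Fin n) R).det ^ s := by
    rw [map_pow, RingHom.map_det]
    congr 2
    ext1 i j
    simp
  rw [← h]
  exact isUnit_apolarPairing_map (pow_ne_zero _ (det_mvPolynomialX_ne_zero _ _))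

/-- A form of Cayley's Ω-process: a semi-invariant value `f` lies in every ideal that contains the
coefficients of the `s`-th power of the generic combination of maximal minors of `φ`. -/
theorem mem_of_linearSubst_eq [Algebra ℚ R] (φ : Matrix (Fin n) (Fin m) R) (s : ℕ) {J : Ideal R}
    (hJ : (φ.map (C (σ := Fin n × Fin m)) * (mvPolynomialX (Fin n) (Fin m) R)ᵀ).det ^ s ∈
      J.map (C : R →+* MvPolynomial (Fin n × Fin m) R))
    {f : R} (P : MvPolynomial (Fin n × Fin m) R)
    (hP : linearSubst ((1 : Matrix (Fin n) (Fin n) R) ⊗ₖ φᵀ) P =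
      C f * (mvPolynomialX (Fin n) (Fin n) R).det ^ s) : f ∈ J := by
  have h := apolarPairing_linearSubst ((1 : Matrix (Fin n) (Fin n) R) ⊗ₖ φᵀ) P
    ((mvPolynomialX (Fin n) (Fin n) R).det ^ s)
  have hQ : linearSubst ((1 : Matrix (Fin n) (Fin n) R) ⊗ₖ φᵀ)ᵀ
      ((mvPolynomialX (Fin n) (Fin n) R).det ^ s) =
      (φ.map (C (σ := Fin n × Fin m)) * (mvPolynomialX (Fin n) (Fin m) R)ᵀ).det ^ s := by
    rw [← kroneckerMap_transpose, transpose_one, transpose_transpose, map_pow, AlgHom.map_det,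
      AlgHom.mapMatrix_apply, mvPolynomialX_map_linearSubst, ← det_transpose, transpose_mul,
      transpose_map, transpose_transpose]
  rw [hP, apolarPairing_C_mul_right, hQ] at h
  rw [← Ideal.mul_unit_mem_iff_mem J (isUnit_apolarPairing_det_pow (n := n) s), h]
  exact apolarPairing_mem hJ P

end MaximalMinors

/-- If `R` is a commutative ring containing `ℚ`, `φ : R^m → R^n` a linear map and `d ≥ 1`,
then `I(S^d(φ)) = I(φ)^s` with `s = (n + d - 1).choose (d - 1)`. -/
theorem maximalMinors_symPow_eq {R : Type*} [CommRing R] [Algebra ℚ R] {m n : ℕ}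
    (φ : Matrix (Fin n) (Fin m) R) (d : ℕ) (hd : 1 ≤ d) :
    minorsIdeal ((n + d - 1).choose d) (symPowMatrix d φ) =
      minorsIdeal n φ ^ ((n + d - 1).choose (d - 1)) := by
  set s := (n + d - 1).choose (d - 1)
  have hcard : Fintype.card (Sym (Fin n) d) = (n + d - 1).choose d := by
    rw [Sym.card_sym_eq_choose, Fintype.card_fin]
  let e : Fin ((n + d - 1).choose d) ≃ Sym (Fin n) d := (Fintype.equivFinOfCardEq hcard).symm
  let Y := Matrix.mvPolynomialX (Fin n) (Fin m) R
  let G := Matrix.mvPolynomialX (Fin n) (Fin n) R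
  let T := linearSubst (Matrix.kronecker (1 : Matrix (Fin n) (Fin n) R) φ.transpose)
  let t : MvPolynomial (Fin n × Fin m) R →+* MvPolynomial (Fin n × Fin n) R := T
  let c : R →+* MvPolynomial (Fin n × Fin n) R := MvPolynomial.C
  have hY : Y.map t = G * φ.map c := by
    have h := mvPolynomialX_map_linearSubst (ι := Fin n) φ.transpose
    rwa [Matrix.transpose_transpose] at h
  apply le_antisymm
  · rw [minorsIdeal_eq_span_range _ e, Ideal.span_le]
    rintro _ ⟨v, rfl⟩
    refine mem_of_linearSubst_eq φ s ?_ (((symPowMatrix d Y).submatrix e v).det) ?_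
    · rw [Ideal.map_pow]
      exact Ideal.pow_mem_pow (minorsIdeal_map_le _ _ (det_mul_mem_minorsIdeal _ _)) s
    · change t _ = c _ * G.det ^ s
      have h : ((symPowMatrix d Y).submatrix e v).map t =
          (symPowMatrix d G).submatrix e e * ((symPowMatrix d φ).submatrix e v).map c := by
        have h' : (symPowMatrix d Y).map t = symPowMatrix d (Y.map t) :=
          (symPowMatrix_map d t Y).symm
        rw [← Matrix.submatrix_map, h', hY, symPowMatrix_mul, symPowMatrix_map,
          ← Matrix.submatrix_map, Matrix.submatrix_mul_equiv]
      rw [RingHom.map_det, RingHom.mapMatrix_apply, h, Matrix.det_mul,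
        Matrix.det_submatrix_equiv_self, det_symPowMatrix d hd, mul_comm, RingHom.map_det]
      rfl
  · rw [minorsIdeal_eq_span_range φ (Equiv.refl (Fin n)), Ideal.span, Submodule.span_pow,
      Submodule.span_le]
    intro x hx
    obtain ⟨v, rfl⟩ := Set.mem_pow.mp hx
    choose w hw using fun k => (v k).2
    refine mem_of_linearSubst_eq φ s ?_ (∏ k, (Y.submatrix id (w k)).det) ?_
    · rw [← det_symPowMatrix d hd, symPowMatrix_mul, symPowMatrix_map]
      exact minorsIdeal_map_le _ _ (det_mul_mem_minorsIdeal_of_equiv e _ _)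
    · change t _ = c _ * G.det ^ s
      have h : ∀ k, t (Y.submatrix id (w k)).det = c (v k) * G.det := fun k => by
        have h' : (Y.submatrix id (w k)).map t = G * (φ.submatrix id (w k)).map c := by
          rw [← Matrix.submatrix_map, hY, ← Matrix.submatrix_map]
          rfl
        rw [RingHom.map_det, RingHom.mapMatrix_apply, h', Matrix.det_mul, ← hw k, mul_comm,
          RingHom.map_det]
        rfl
      rw [map_prod, Finset.prod_congr rfl fun k _ => h k, Finset.prod_mul_distrib,
        Finset.prod_const, Finset.card_univ, Fintype.card_fin, List.prod_ofFn, map_prod]
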